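/- arXiv:1203.2078 — 5 statements merged into one kernel-verified Lean document; each statement's English description precedes it below -/
import Mathlib

section
/- Assume Conditions (D) and (H). Then the pre-Dirichlet form (E, C_c²(E)) is closable on L²(E; μ_{n,s,ϱ}): for every sequence (f_k)_{k∈ℕ} in C_c²(E) with E(f_k − f_l, f_k − f_l) → 0 as k, l → ∞ and ‖f_k‖_{L²(E; μ_{n,s,ϱ})} → 0 as k → ∞, one has E(f_k, f_k) → 0 as k → ∞. -/
open MeasureTheory ENNReal Set Filter
open scoped Classical

noncomputable section

variable {ι : Type*} [Fintype ι]

/-- Partial derivative of `f` in the `i`-th coordinate direction. -/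
def pderiv' (i : ι) (f : (ι → ℝ) → ℝ) (x : ι → ℝ) : ℝ :=
  fderiv ℝ f x (Pi.single i 1)

/-- The measure `λ_B^{(n)}`: product of Lebesgue measure on `[0,∞)` in coordinates in `B`
and Dirac measure at `0` in the remaining coordinates. -/
def lamB (B : Finset ι) : Measure (ι → ℝ) :=
  Measure.pi (fun i => if i ∈ B then volume.restrict (Set.Ici (0 : ℝ)) else Measure.dirac 0)

/-- The measure `λ_B^{n,s} = s^(n - #B) · λ_B^{(n)}`. -/
def lamBs (s : ℝ) (B : Finset ι) : Measure (ι → ℝ) :=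
  (ENNReal.ofReal (s ^ (Fintype.card ι - B.card))) • lamB B

/-- The measure `m_{n,s} = Σ_{B ⊆ I} λ_B^{n,s}`. -/
def mns (ι : Type*) [Fintype ι] (s : ℝ) : Measure (ι → ℝ) :=
  ∑ B : Finset ι, lamBs s B

/-- The measure `μ_{n,s,ϱ} = ϱ · m_{n,s}`. -/
def muM (s : ℝ) (ϱ : (ι → ℝ) → ℝ) : Measure (ι → ℝ) :=
  (mns ι s).withDensity (fun x => ENNReal.ofReal (ϱ x))

/-- The state space `E = [0,∞)^n`. -/
def Esp (ι : Type*) [Fintype ι] : Set (ι → ℝ) := {x | ∀ i, 0 ≤ x i}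

/-- `E_+(B) = {x ∈ E | x_i > 0 for i ∈ B, x_i = 0 for i ∉ B}`. -/
def Eplus (B : Finset ι) : Set (ι → ℝ) := {x | (∀ i ∈ B, 0 < x i) ∧ ∀ i ∉ B, x i = 0}

/-- Euclidean distance on `ι → ℝ`. -/
def distE (x y : ι → ℝ) : ℝ := Real.sqrt (∑ i, (x i - y i) ^ 2)

/-- The set `R_ϱ(cl E_+(B))` of points near which `ϱ⁻¹` is `λ_B^{n,s}`-integrable. -/
def Rset (s : ℝ) (ϱ : (ι → ℝ) → ℝ) (B : Finset ι) : Set (ι → ℝ) :=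
  {x ∈ closure (Eplus B) | ∃ ε > 0,
    ∫⁻ y in {y ∈ closure (Eplus B) | distE x y ≤ ε}, ENNReal.ofReal ((ϱ y)⁻¹) ∂(lamBs s B) < ⊤}

/-- The Hamza condition (Condition (H)). -/
def CondH (s : ℝ) (ϱ : (ι → ℝ) → ℝ) : Prop :=
  ∀ B : Finset ι, B.Nonempty →
    ∀ᵐ x ∂((lamBs s B).restrict (closure (Eplus B) \ Rset s ϱ B)), ϱ x = 0

/-- The pre-Dirichlet form `E(f,g) = Σ_{∅≠B⊆I} Σ_{i∈B} ∫_{E_+(B)} ∂_i f ∂_i g ϱ dλ_B^{n,s}`. -/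
def dirForm (s : ℝ) (ϱ f g : (ι → ℝ) → ℝ) : ℝ :=
  ∑ B : Finset ι, ∑ i ∈ B, ∫ x in Eplus B, pderiv' i f x * pderiv' i g x * ϱ x ∂(lamBs s B)

end

section TranslationInvariance

/-- If a locally finite measure is invariant under translations along `v`, then the directional
derivative along `v` of a compactly supported `C¹` function has vanishing integral. -/
theorem integral_fderiv_eq_zero_of_invariant {E : Type*} [NormedAddCommGroup E] [NormedSpace ℝ E]
    [MeasurableSpace E] [BorelSpace E] [SecondCountableTopology E]
    (μ : Measure E) [IsFiniteMeasureOnCompacts μ] (v : E)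
    (hμ : ∀ t : ℝ, MeasurePreserving (fun x => x + t • v) μ μ)
    {h : E → ℝ} (hh : ContDiff ℝ 1 h) (hc : HasCompactSupport h) :
    ∫ x, fderiv ℝ h x v ∂μ = 0 := by
  have hcont : Continuous (fun x => fderiv ℝ h x v) :=
    (hh.continuous_fderiv one_ne_zero).clm_apply continuous_const
  have hcs : HasCompactSupport (fun x => fderiv ℝ h x v) := hc.fderiv_apply ℝ v
  obtain ⟨C, hC⟩ := hcs.exists_bound_of_continuous hcont
  have hK : IsCompact ((fun p : E × ℝ => p.1 - p.2 • v) '' (tsupport h ×ˢ Icc (-1) 1)) :=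
    (hc.isCompact.prod isCompact_Icc).image (by fun_prop)
  set K := (fun p : E × ℝ => p.1 - p.2 • v) '' (tsupport h ×ˢ Icc (-1) 1)
  have key := hasDerivAt_integral_of_dominated_loc_of_deriv_le (μ := μ) (𝕜 := ℝ)
    (F := fun t x => h (x + t • v)) (F' := fun t x => fderiv ℝ h (x + t • v) v) (x₀ := 0)
    (s := Metric.ball 0 1) (bound := K.indicator fun _ => C)
    (Metric.ball_mem_nhds _ one_pos)
    (Eventually.of_forall fun t =>
      (hh.continuous.comp (by fun_prop : Continuous fun x => x + t • v)).aestronglyMeasurable)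
    (by simpa using hh.continuous.integrable_of_hasCompactSupport hc)
    (by simpa using hcont.aestronglyMeasurable)
    (by
      refine Eventually.of_forall fun x t ht => ?_
      by_cases hx : x ∈ K
      · rw [indicator_of_mem hx]; exact hC _
      · rw [indicator_of_notMem hx]
        have : x + t • v ∉ tsupport h := by
          intro hmem
          refine hx ⟨(x + t • v, t), ⟨hmem, ?_⟩, by simp⟩
          rw [Metric.mem_ball, dist_zero_right, Real.norm_eq_abs, abs_lt] at ht
          exact ⟨ht.1.le, ht.2.le⟩
        have h0 : fderiv ℝ h (x + t • v) = 0 := by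
          by_contra hne
          exact this (support_fderiv_subset ℝ hne)
        simp [h0])
    ((integrable_indicator_iff hK.measurableSet).2
      (integrableOn_const hK.measure_lt_top.ne))
    (by
      refine Eventually.of_forall fun x t _ => ?_
      have h1 : HasDerivAt (fun t : ℝ => x + t • v) v t := by
        simpa using ((hasDerivAt_id t).smul_const v).const_add x
      exact ((hh.differentiable one_ne_zero _).hasFDerivAt).comp_hasDerivAt t h1)
  have hconst : (fun t : ℝ => ∫ x, h (x + t • v) ∂μ) = fun _ => ∫ x, h x ∂μ := by
    funext t
    have := (hμ t).map_eq
    conv_rhs => rw [← this]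
    rw [integral_map (hμ t).aemeasurable hh.continuous.aestronglyMeasurable]
  have h2 := key.2
  rw [hconst] at h2
  simpa using h2.unique (hasDerivAt_const _ _)

end TranslationInvariance

section SquareIntegrable

variable {α : Type*} [MeasurableSpace α] {μ : Measure α}

theorem inner_toLp_eq_integral {w v : α → ℝ} (hw : MemLp w 2 μ) (hv : MemLp v 2 μ) :
    inner ℝ (hw.toLp w) (hv.toLp v) = ∫ x, w x * v x ∂μ := by
  rw [L2.inner_def]
  refine integral_congr_ae ?_
  filter_upwards [hw.coeFn_toLp, hv.coeFn_toLp] with x h1 h2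
  rw [h1, h2]
  simp [mul_comm]

theorem norm_toLp_sq_eq_integral {w : α → ℝ} (hw : MemLp w 2 μ) :
    ‖hw.toLp w‖ ^ 2 = ∫ x, w x ^ 2 ∂μ := by
  rw [← real_inner_self_eq_norm_sq, inner_toLp_eq_integral]
  simp [sq]

/-- A sequence that is Cauchy in `L²` has an `L²` limit; it tends to zero in `L²` as soon as
every such limit vanishes almost everywhere. -/
theorem tendsto_integral_sq_zero_of_cauchy {u : ℕ → α → ℝ} (hu : ∀ k, MemLp (u k) 2 μ)
    (hC : Tendsto (fun p : ℕ × ℕ => ∫ x, (u p.1 x - u p.2 x) ^ 2 ∂μ) atTop (nhds 0))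
    (hzero : ∀ g : Lp ℝ 2 μ, Tendsto (fun k => (hu k).toLp (u k)) atTop (nhds g) →
      g =ᵐ[μ] 0) :
    Tendsto (fun k => ∫ x, u k x ^ 2 ∂μ) atTop (nhds 0) := by
  have hCs : CauchySeq (fun k => (hu k).toLp (u k)) := by
    rw [cauchySeq_iff_tendsto_dist_atTop_0]
    have := hC.sqrt
    rw [Real.sqrt_zero] at this
    refine this.congr fun p => ?_
    rw [dist_eq_norm, ← MemLp.toLp_sub, ← Real.sqrt_sq (norm_nonneg _), norm_toLp_sq_eq_integral]
    rfl
  obtain ⟨g, hg⟩ := cauchySeq_tendsto_of_complete hCs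
  have hg0 : g = 0 := Lp.eq_zero_iff_ae_eq_zero.2 (hzero g hg)
  have := (hg.norm).pow 2
  rw [hg0] at this
  simp only [norm_toLp_sq_eq_integral, norm_zero] at this
  simpa using this

end SquareIntegrable

section WeightedMeasure

variable {α : Type*} [MeasurableSpace α] {μ : Measure α} {ϱ : α → ℝ}

theorem integral_withDensity_ofReal_eq (hm : Measurable ϱ) (hnn : ∀ x, 0 ≤ ϱ x) (g : α → ℝ) :
    ∫ x, g x ∂(μ.withDensity fun x => ENNReal.ofReal (ϱ x)) = ∫ x, ϱ x * g x ∂μ := by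
  rw [integral_withDensity_eq_integral_toReal_smul hm.ennreal_ofReal (by simp)]
  simp [ENNReal.toReal_ofReal (hnn _)]

theorem integrable_withDensity_ofReal_iff (hm : Measurable ϱ) (hnn : ∀ x, 0 ≤ ϱ x) {g : α → ℝ} :
    Integrable g (μ.withDensity fun x => ENNReal.ofReal (ϱ x)) ↔
      Integrable (fun x => ϱ x * g x) μ := by
  rw [integrable_withDensity_iff_integrable_smul' hm.ennreal_ofReal (by simp)]
  simp [ENNReal.toReal_ofReal (hnn _)]

/-- If `ϱ⁻¹` is integrable on `U`, then `ψ / ϱ` is square integrable with respect to `ϱ · μ` for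
every bounded measurable function `ψ` vanishing outside `U`. -/
theorem memLp_two_div_withDensity (hm : Measurable ϱ) (hnn : ∀ x, 0 ≤ ϱ x)
    (hpos : ∀ᵐ x ∂μ, 0 < ϱ x) {U : Set α} (hU : MeasurableSet U)
    (hint : IntegrableOn (fun x => (ϱ x)⁻¹) U μ)
    {ψ : α → ℝ} (hψ : Measurable ψ) {C : ℝ} (hC : ∀ x, ‖ψ x‖ ≤ C) (hψU : ∀ x ∉ U, ψ x = 0) :
    MemLp (fun x => ψ x / ϱ x) 2 (μ.withDensity fun x => ENNReal.ofReal (ϱ x)) := by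
  rw [memLp_two_iff_integrable_sq (Measurable.aestronglyMeasurable (by fun_prop)),
    integrable_withDensity_ofReal_iff hm hnn]
  have h1 : Integrable (U.indicator fun x => (ϱ x)⁻¹) μ := (integrable_indicator_iff hU).2 hint
  have h2 := h1.bdd_mul (f := fun x => ψ x ^ 2) (c := C ^ 2) (hψ.pow_const 2).aestronglyMeasurable
    (Eventually.of_forall fun x => by
      rw [norm_pow]; exact pow_le_pow_left₀ (norm_nonneg _) (hC x) 2)
  refine h2.congr ?_
  filter_upwards [hpos] with x hx
  by_cases hxU : x ∈ U
  · rw [indicator_of_mem hxU]; field_simp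
  · simp [hψU x hxU]

theorem integral_div_mul_withDensity (hm : Measurable ϱ) (hnn : ∀ x, 0 ≤ ϱ x)
    (hpos : ∀ᵐ x ∂μ, 0 < ϱ x) (ψ v : α → ℝ) :
    ∫ x, ψ x / ϱ x * v x ∂(μ.withDensity fun x => ENNReal.ofReal (ϱ x)) = ∫ x, ψ x * v x ∂μ := by
  rw [integral_withDensity_ofReal_eq hm hnn]
  refine integral_congr_ae ?_
  filter_upwards [hpos] with x hx
  field_simp

theorem MeasureTheory.MemLp.integrableOn_of_withDensity (hm : Measurable ϱ) (hnn : ∀ x, 0 ≤ ϱ x)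
    (hpos : ∀ᵐ x ∂μ, 0 < ϱ x) {U : Set α} (hU : MeasurableSet U)
    (hint : IntegrableOn (fun x => (ϱ x)⁻¹) U μ) {v : α → ℝ}
    (hv : MemLp v 2 (μ.withDensity fun x => ENNReal.ofReal (ϱ x))) : IntegrableOn v U μ := by
  have h1 := memLp_two_div_withDensity hm hnn hpos hU hint (ψ := U.indicator fun _ => (1 : ℝ))
    (measurable_const.indicator hU) (C := 1)
    (fun x => by by_cases hx : x ∈ U <;> simp [hx]) (fun x hx => by simp [hx])
  have h2 := (integrable_withDensity_ofReal_iff hm hnn).1 (h1.integrable_mul hv)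
  rw [← integrable_indicator_iff hU]
  refine h2.congr ?_
  filter_upwards [hpos] with x hx
  by_cases hxU : x ∈ U
  · simp only [Pi.mul_apply, indicator_of_mem hxU]; field_simp
  · simp [hxU]

/-- Testing against a bounded function supported where `ϱ⁻¹` is integrable is continuous with
respect to convergence in `L²(ϱ · μ)`. -/
theorem tendsto_integral_mul_of_tendsto_toLp (hm : Measurable ϱ) (hnn : ∀ x, 0 ≤ ϱ x)
    (hpos : ∀ᵐ x ∂μ, 0 < ϱ x) {U : Set α} (hU : MeasurableSet U)
    (hint : IntegrableOn (fun x => (ϱ x)⁻¹) U μ)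
    {ψ : α → ℝ} (hψ : Measurable ψ) {C : ℝ} (hC : ∀ x, ‖ψ x‖ ≤ C) (hψU : ∀ x ∉ U, ψ x = 0)
    {u : ℕ → α → ℝ} (hu : ∀ k, MemLp (u k) 2 (μ.withDensity fun x => ENNReal.ofReal (ϱ x)))
    {g : Lp ℝ 2 (μ.withDensity fun x => ENNReal.ofReal (ϱ x))}
    (hg : Tendsto (fun k => (hu k).toLp (u k)) atTop (nhds g)) :
    Tendsto (fun k => ∫ x, ψ x * u k x ∂μ) atTop (nhds (∫ x, ψ x * g x ∂μ)) := by
  have hw := memLp_two_div_withDensity hm hnn hpos hU hint hψ hC hψU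
  have h := (tendsto_const_nhds (x := hw.toLp _)).inner (𝕜 := ℝ) hg
  have hgg : inner ℝ (hw.toLp _) g = ∫ x, ψ x * g x ∂μ := by
    rw [← integral_div_mul_withDensity hm hnn hpos, ← inner_toLp_eq_integral hw (Lp.memLp g),
      Lp.toLp_coeFn]
  rw [hgg] at h
  refine h.congr fun k => ?_
  rw [inner_toLp_eq_integral, integral_div_mul_withDensity hm hnn hpos]

end WeightedMeasure

section BoundaryMeasures

variable {ι : Type*} [Fintype ι]

/-- The product of Lebesgue measure on `ℝ` in the coordinates in `B` and Dirac measure at `0` in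
the remaining coordinates. -/
noncomputable def lamFull (B : Finset ι) : Measure (ι → ℝ) :=
  Measure.pi (fun i => if i ∈ B then volume else Measure.dirac 0)

instance sigmaFinite_ite_volume_dirac (B : Finset ι) (i : ι) :
    SigmaFinite (if i ∈ B then volume else Measure.dirac 0 : Measure ℝ) := by
  split_ifs <;> infer_instance

instance sigmaFinite_ite_restrict_dirac (B : Finset ι) (i : ι) :
    SigmaFinite (if i ∈ B then volume.restrict (Set.Ici (0 : ℝ)) else Measure.dirac 0) := by
  split_ifs <;> infer_instance

instance isLocallyFiniteMeasure_ite_volume_dirac (B : Finset ι) (i : ι) :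
    IsLocallyFiniteMeasure (if i ∈ B then volume else Measure.dirac 0 : Measure ℝ) := by
  split_ifs <;> infer_instance

instance isLocallyFiniteMeasure_lamFull (B : Finset ι) : IsLocallyFiniteMeasure (lamFull B) := by
  unfold lamFull; infer_instance

theorem lamB_eq_restrict_lamFull (B : Finset ι) :
    lamB B = (lamFull B).restrict (univ.pi fun _ => Ici 0) := by
  rw [lamFull, Measure.restrict_pi_pi, lamB]
  congr 1
  funext i
  split_ifs
  · rfl
  · rw [restrict_dirac' measurableSet_Ici, if_pos (by simp)]

theorem measurePreserving_add_smul_single_lamFull {B : Finset ι} {i : ι} (hi : i ∈ B) (t : ℝ) :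
    MeasurePreserving (fun x : ι → ℝ => x + t • Pi.single i 1) (lamFull B) (lamFull B) := by
  have := measurePreserving_pi
    (fun j => (if j ∈ B then volume else Measure.dirac 0 : Measure ℝ))
    (fun j => (if j ∈ B then volume else Measure.dirac 0 : Measure ℝ))
    (f := fun j y => y + t * (Pi.single i 1 : ι → ℝ) j) fun j => by
      by_cases hj : j = i
      · subst hj
        simp only [hi, if_true]
        exact measurePreserving_add_right volume _
      · simp only [Pi.single_eq_of_ne hj, mul_zero, add_zero]
        exact MeasurePreserving.id _
  exact this

theorem ae_mem_Eplus_lamB (B : Finset ι) : ∀ᵐ x ∂(lamB B), x ∈ Eplus B := by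
  have h : ∀ i, ∀ᵐ x ∂(lamB B), (i ∈ B → 0 < x i) ∧ (i ∉ B → x i = 0) := fun i => by
    refine (Measure.tendsto_eval_ae_ae (i := i)).eventually
      (p := fun y : ℝ => (i ∈ B → 0 < y) ∧ (i ∉ B → y = 0)) ?_
    by_cases hi : i ∈ B
    · simp only [hi, if_true, forall_const, not_true_eq_false, false_imp_iff, and_true]
      rw [← restrict_Ioi_eq_restrict_Ici]
      exact ae_restrict_mem measurableSet_Ioi
    · simp [hi, ae_dirac_eq]
  filter_upwards [eventually_all.2 h] with x hx
  exact ⟨fun i hi => (hx i).1 hi, fun i hi => (hx i).2 hi⟩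

theorem ae_mem_Eplus (s : ℝ) (B : Finset ι) : ∀ᵐ x ∂(lamBs s B), x ∈ Eplus B :=
  Measure.ae_smul_measure (ae_mem_Eplus_lamB B) _

omit [Fintype ι] in
theorem isOpen_setOf_forall_mem_pos (B : Finset ι) : IsOpen {x : ι → ℝ | ∀ i ∈ B, 0 < x i} := by
  simp only [Set.ofPred_forall]
  exact isOpen_biInter_finset fun i _ => isOpen_lt continuous_const (continuous_apply i)

theorem restrict_Eplus_lamBs (s : ℝ) (B : Finset ι) :
    (lamBs s B).restrict (Eplus B) = lamBs s B :=
  Measure.restrict_eq_self_of_ae_mem (ae_mem_Eplus s B)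

theorem lamBs_le_mns (s : ℝ) (B : Finset ι) : lamBs s B ≤ mns ι s :=
  Finset.single_le_sum (f := fun B => lamBs s B) (fun _ _ => Measure.zero_le _) (Finset.mem_univ B)

/-- Compactly supported `C¹` functions on the open set where all coordinates in `B` are positive
have directional derivatives of vanishing `λ_B^{n,s}`-integral. -/
theorem integral_pderiv'_eq_zero (s : ℝ) {B : Finset ι} {i : ι} (hi : i ∈ B) {h : (ι → ℝ) → ℝ}
    (hh : ContDiff ℝ 1 h) (hc : HasCompactSupport h)
    (hsupp : tsupport h ⊆ {x | ∀ i ∈ B, 0 < x i}) :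
    ∫ x, pderiv' i h x ∂(lamBs s B) = 0 := by
  have h0 := integral_fderiv_eq_zero_of_invariant (lamFull B) (Pi.single i 1)
    (measurePreserving_add_smul_single_lamFull hi) hh hc
  have hae : ∀ᵐ x ∂(lamFull B), ∀ j, j ∉ B → x j = 0 := by
    refine eventually_all.2 fun j => ?_
    refine (Measure.tendsto_eval_ae_ae (i := j)).eventually (p := fun y : ℝ => j ∉ B → y = 0) ?_
    by_cases hj : j ∈ B
    · simp [hj]
    · simp [hj, ae_dirac_eq]
  rw [lamBs, integral_smul_measure, lamB_eq_restrict_lamFull,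
    setIntegral_eq_integral_of_ae_compl_eq_zero]
  · simp only [pderiv', h0, smul_zero]
  · filter_upwards [hae] with x hx hxn
    by_contra hne
    have hmem : x ∈ tsupport h := support_fderiv_subset ℝ fun h0 => hne (by simp [pderiv', h0])
    refine hxn fun j _ => ?_
    by_cases hj : j ∈ B
    · exact (hsupp hmem j hj).le
    · exact (hx j hj).ge

end BoundaryMeasures

section Closability

variable {ι : Type*} [Fintype ι]

theorem continuous_pderiv' (i : ι) {h : (ι → ℝ) → ℝ} (hh : ContDiff ℝ 1 h) :
    Continuous (pderiv' i h) :=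
  (hh.continuous_fderiv one_ne_zero).clm_apply continuous_const

omit [Fintype ι] in
theorem hasCompactSupport_pderiv' (i : ι) {h : (ι → ℝ) → ℝ} (hc : HasCompactSupport h) :
    HasCompactSupport (pderiv' i h) :=
  hc.fderiv_apply ℝ _

theorem pderiv'_sub (i : ι) {g h : (ι → ℝ) → ℝ} (hg : ContDiff ℝ 1 g) (hh : ContDiff ℝ 1 h)
    (x : ι → ℝ) : pderiv' i (g - h) x = pderiv' i g x - pderiv' i h x := by
  simp only [pderiv']
  rw [fderiv_sub (hg.differentiable one_ne_zero x) (hh.differentiable one_ne_zero x)]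
  rfl

theorem pderiv'_mul (i : ι) {g h : (ι → ℝ) → ℝ} (hg : ContDiff ℝ 1 g) (hh : ContDiff ℝ 1 h)
    (x : ι → ℝ) : pderiv' i (g * h) x = g x * pderiv' i h x + pderiv' i g x * h x := by
  simp only [pderiv']
  rw [fderiv_mul (hg.differentiable one_ne_zero x) (hh.differentiable one_ne_zero x)]
  simp [mul_comm]

omit [Fintype ι] in
theorem support_pderiv'_subset (i : ι) (h : (ι → ℝ) → ℝ) :
    Function.support (pderiv' i h) ⊆ tsupport h := fun _ hx =>
  support_fderiv_subset ℝ fun h0 => hx (by simp [pderiv', h0])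

instance isLocallyFiniteMeasure_lamBs (s : ℝ) (B : Finset ι) :
    IsLocallyFiniteMeasure (lamBs s B) := by
  have : IsLocallyFiniteMeasure (lamB B) := by
    rw [lamB_eq_restrict_lamFull]; infer_instance
  exact inferInstanceAs
    (IsLocallyFiniteMeasure (Real.toNNReal (s ^ (Fintype.card ι - B.card)) • lamB B))

/-- Integration by parts on the boundary stratum `E_+(B)`. -/
theorem integral_mul_pderiv'_eq_neg (s : ℝ) {B : Finset ι} {i : ι} (hi : i ∈ B)
    {g h : (ι → ℝ) → ℝ} (hg : ContDiff ℝ 1 g) (hgc : HasCompactSupport g)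
    (hsupp : tsupport g ⊆ {x | ∀ i ∈ B, 0 < x i}) (hh : ContDiff ℝ 1 h) :
    ∫ x, g x * pderiv' i h x ∂(lamBs s B) = -∫ x, pderiv' i g x * h x ∂(lamBs s B) := by
  have h0 := integral_pderiv'_eq_zero s hi (h := g * h) (hg.mul hh) hgc.mul_right
    ((closure_mono (Function.support_mul_subset_left g h)).trans hsupp)
  rw [integral_congr_ae (Eventually.of_forall fun x => pderiv'_mul i hg hh x), integral_add] at h0
  · linarith
  · exact (hg.continuous.mul (continuous_pderiv' i hh)).integrable_of_hasCompactSupport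
      hgc.mul_right
  · exact ((continuous_pderiv' i hg).mul hh.continuous).integrable_of_hasCompactSupport
      (hasCompactSupport_pderiv' i hgc).mul_right

variable {s : ℝ} {ϱ : (ι → ℝ) → ℝ} {B : Finset ι}

/-- On an open subset of the positive cone on which `ϱ⁻¹` is integrable, any `L²` limit of partial
derivatives of a null sequence vanishes. -/
theorem ae_eq_zero_on_of_tendsto_pderiv' (hmeas : Measurable ϱ) (hnn : ∀ x, 0 ≤ ϱ x)
    (hpos : ∀ᵐ x ∂(lamBs s B), 0 < ϱ x) {i : ι} (hi : i ∈ B) {f : ℕ → (ι → ℝ) → ℝ}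
    (hf : ∀ k, ContDiff ℝ 1 (f k))
    (hfL : ∀ k, MemLp (f k) 2 ((lamBs s B).withDensity fun x => ENNReal.ofReal (ϱ x)))
    (hdL : ∀ k, MemLp (pderiv' i (f k)) 2
      ((lamBs s B).withDensity fun x => ENNReal.ofReal (ϱ x)))
    (hf0 : Tendsto (fun k => (hfL k).toLp (f k)) atTop (nhds 0))
    {g : Lp ℝ 2 ((lamBs s B).withDensity fun x => ENNReal.ofReal (ϱ x))}
    (hg : Tendsto (fun k => (hdL k).toLp (pderiv' i (f k))) atTop (nhds g))
    {U : Set (ι → ℝ)} (hU : IsOpen U) (hUpos : U ⊆ {x | ∀ i ∈ B, 0 < x i})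
    (hint : IntegrableOn (fun x => (ϱ x)⁻¹) U (lamBs s B)) :
    ∀ᵐ x ∂(lamBs s B), x ∈ U → g x = 0 := by
  refine hU.ae_eq_zero_of_integral_contDiff_smul_eq_zero
    ((Lp.memLp g).integrableOn_of_withDensity hmeas hnn hpos hU.measurableSet
      hint).locallyIntegrableOn fun φ hφ hφc hφU => ?_
  have hφ1 : ContDiff ℝ 1 φ := hφ.of_le (by exact_mod_cast le_top)
  obtain ⟨C, hC⟩ := hφc.exists_bound_of_continuous hφ1.continuous
  have hdc := continuous_pderiv' i hφ1
  obtain ⟨D, hD⟩ := (hasCompactSupport_pderiv' i hφc).exists_bound_of_continuous hdc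
  have h1 := tendsto_integral_mul_of_tendsto_toLp hmeas hnn hpos hU.measurableSet hint
    hφ1.continuous.measurable hC
    (fun x hx => image_eq_zero_of_notMem_tsupport fun hm => hx (hφU hm)) hdL hg
  have h2 := tendsto_integral_mul_of_tendsto_toLp hmeas hnn hpos hU.measurableSet hint
    hdc.measurable hD
    (fun x hx => by_contra fun hne => hx (hφU (support_pderiv'_subset i φ hne))) hfL hf0
  have hz : ∫ x, pderiv' i φ x *
      (0 : Lp ℝ 2 ((lamBs s B).withDensity fun x => ENNReal.ofReal (ϱ x))) x ∂(lamBs s B) = 0 := by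
    rw [← integral_div_mul_withDensity hmeas hnn hpos]
    refine integral_eq_zero_of_ae ?_
    filter_upwards [Lp.coeFn_zero ℝ 2 ((lamBs s B).withDensity fun x => ENNReal.ofReal (ϱ x))]
      with x hx
    rw [hx]; simp
  rw [hz] at h2
  have h3 := h2.neg
  rw [neg_zero] at h3
  exact tendsto_nhds_unique
    (h1.congr fun k => integral_mul_pderiv'_eq_neg s hi hφ1 hφc (hφU.trans hUpos) (hf k)) h3

theorem continuous_distE (x : ι → ℝ) : Continuous (distE x) := by
  unfold distE; fun_prop

/-- Every point of `R_ϱ(cl E_+(B))` in `E_+(B)` has an open neighbourhood in the positive cone on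
which `ϱ⁻¹` is integrable. -/
theorem exists_isOpen_integrableOn_inv (hmeas : Measurable ϱ) (hnn : ∀ x, 0 ≤ ϱ x)
    {x : ι → ℝ} (hxR : x ∈ Rset s ϱ B) (hx : x ∈ Eplus B) :
    ∃ U, IsOpen U ∧ x ∈ U ∧ U ⊆ {x | ∀ i ∈ B, 0 < x i} ∧
      IntegrableOn (fun x => (ϱ x)⁻¹) U (lamBs s B) := by
  obtain ⟨-, ε, hε, hlt⟩ := hxR
  refine ⟨{y | distE x y < ε} ∩ {y | ∀ i ∈ B, 0 < y i},
    (isOpen_lt (continuous_distE x) continuous_const).inter (isOpen_setOf_forall_mem_pos B),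
    ⟨by simpa [distE] using hε, hx.1⟩, inter_subset_right, ?_⟩
  have hball : IntegrableOn (fun x => (ϱ x)⁻¹) {y ∈ closure (Eplus B) | distE x y ≤ ε}
      (lamBs s B) := by
    refine ⟨hmeas.inv.aestronglyMeasurable, ?_⟩
    rw [hasFiniteIntegral_iff_ofReal (Eventually.of_forall fun y => inv_nonneg.2 (hnn y))]
    exact hlt
  refine hball.mono_set_ae ?_
  filter_upwards [ae_mem_Eplus s B] with y hy hyU
  exact ⟨subset_closure hy, hyU.1.le⟩

/-- Under the Hamza condition almost every point lies in `R_ϱ(cl E_+(B))`. -/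
theorem ae_mem_Rset (hH : CondH s ϱ) (hB : B.Nonempty) (hpos : ∀ᵐ x ∂(lamBs s B), 0 < ϱ x) :
    ∀ᵐ x ∂(lamBs s B), x ∈ Rset s ϱ B := by
  have h1 := ae_imp_of_ae_restrict (hH B hB)
  filter_upwards [h1, hpos, ae_mem_Eplus s B] with x hx hp hE
  by_contra hn
  exact hp.ne' (hx ⟨subset_closure hE, hn⟩)

theorem ae_of_forall_mem_exists_isOpen {X : Type*} [TopologicalSpace X] [SecondCountableTopology X]
    [MeasurableSpace X] {μ : Measure X} {S : Set X} (hS : ∀ᵐ x ∂μ, x ∈ S) {p : X → Prop}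
    (h : ∀ x ∈ S, ∃ U, IsOpen U ∧ x ∈ U ∧ ∀ᵐ y ∂μ, y ∈ U → p y) : ∀ᵐ x ∂μ, p x := by
  have h0 : μ {x | x ∈ S ∧ ¬ p x} = 0 := by
    refine measure_null_of_locally_null _ fun x hx => ?_
    obtain ⟨U, hUo, hxU, hU⟩ := h x hx.1
    refine ⟨U ∩ {x | x ∈ S ∧ ¬ p x}, inter_mem (mem_nhdsWithin_of_mem_nhds (hUo.mem_nhds hxU)) self_mem_nhdsWithin, ?_⟩
    refine measure_mono_null ?_ (ae_iff.1 hU)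
    rintro y ⟨hy, -, hpy⟩ himp
    exact hpy (himp hy)
  have h1 : ∀ᵐ x ∂μ, ¬ (x ∈ S ∧ ¬ p x) := by simpa [ae_iff] using h0
  filter_upwards [hS, h1] with x hx hx1
  exact not_not.1 fun hp => hx1 ⟨hx, hp⟩

theorem isFiniteMeasure_withDensity_lamBs (hint : Integrable ϱ (mns ι s)) (B : Finset ι) :
    IsFiniteMeasure ((lamBs s B).withDensity fun x => ENNReal.ofReal (ϱ x)) :=
  isFiniteMeasure_withDensity_ofReal (hint.mono_measure (lamBs_le_mns s B)).2

/-- Closability of a single directional energy on the stratum `E_+(B)`. -/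
theorem tendsto_integral_sq_pderiv'_zero (hmeas : Measurable ϱ) (hnn : ∀ x, 0 ≤ ϱ x)
    (hpos : ∀ᵐ x ∂(mns ι s), 0 < ϱ x) (hint : Integrable ϱ (mns ι s)) (hH : CondH s ϱ)
    {i : ι} (hi : i ∈ B) {f : ℕ → (ι → ℝ) → ℝ}
    (hf : ∀ k, ContDiff ℝ 1 (f k) ∧ HasCompactSupport (f k))
    (hC : Tendsto (fun p : ℕ × ℕ => ∫ x, (pderiv' i (f p.1) x - pderiv' i (f p.2) x) ^ 2
      ∂((lamBs s B).withDensity fun x => ENNReal.ofReal (ϱ x))) atTop (nhds 0))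
    (hL2 : Tendsto (fun k => ∫ x, f k x ^ 2
      ∂((lamBs s B).withDensity fun x => ENNReal.ofReal (ϱ x))) atTop (nhds 0)) :
    Tendsto (fun k => ∫ x, pderiv' i (f k) x ^ 2
      ∂((lamBs s B).withDensity fun x => ENNReal.ofReal (ϱ x))) atTop (nhds 0) := by
  have := isFiniteMeasure_withDensity_lamBs hint B
  have hposB : ∀ᵐ x ∂(lamBs s B), 0 < ϱ x := ae_mono (lamBs_le_mns s B) hpos
  have hfL : ∀ k, MemLp (f k) 2 ((lamBs s B).withDensity fun x => ENNReal.ofReal (ϱ x)) :=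
    fun k => (hf k).1.continuous.memLp_of_hasCompactSupport (hf k).2
  have hdL : ∀ k, MemLp (pderiv' i (f k)) 2
      ((lamBs s B).withDensity fun x => ENNReal.ofReal (ϱ x)) :=
    fun k => (continuous_pderiv' i (hf k).1).memLp_of_hasCompactSupport
      (hasCompactSupport_pderiv' i (hf k).2)
  have hf0 : Tendsto (fun k => (hfL k).toLp (f k)) atTop (nhds 0) := by
    rw [tendsto_zero_iff_norm_tendsto_zero]
    have := hL2.sqrt
    rw [Real.sqrt_zero] at this
    refine this.congr fun k => ?_
    rw [← norm_toLp_sq_eq_integral (hfL k), Real.sqrt_sq (norm_nonneg _)]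
  refine tendsto_integral_sq_zero_of_cauchy hdL hC fun g hg => ?_
  refine (withDensity_absolutelyContinuous _ _).ae_le ?_
  refine ae_of_forall_mem_exists_isOpen
    ((ae_mem_Rset hH ⟨i, hi⟩ hposB).and (ae_mem_Eplus s B)) fun x hx => ?_
  obtain ⟨U, hUo, hxU, hUpos, hUint⟩ := exists_isOpen_integrableOn_inv hmeas hnn hx.1 hx.2
  exact ⟨U, hUo, hxU, ae_eq_zero_on_of_tendsto_pderiv' hmeas hnn hposB hi (fun k => (hf k).1)
    hfL hdL hf0 hg hUo hUpos hUint⟩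

theorem dirForm_self_eq (hmeas : Measurable ϱ) (hnn : ∀ x, 0 ≤ ϱ x) (g : (ι → ℝ) → ℝ) :
    dirForm s ϱ g g = ∑ B : Finset ι, ∑ i ∈ B, ∫ x, pderiv' i g x ^ 2
      ∂((lamBs s B).withDensity fun x => ENNReal.ofReal (ϱ x)) := by
  refine Finset.sum_congr rfl fun B _ => Finset.sum_congr rfl fun i _ => ?_
  rw [restrict_Eplus_lamBs, integral_withDensity_ofReal_eq hmeas hnn]
  exact integral_congr_ae (Eventually.of_forall fun x => by ring)

theorem integral_sq_pderiv'_le_dirForm (hmeas : Measurable ϱ) (hnn : ∀ x, 0 ≤ ϱ x)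
    (g : (ι → ℝ) → ℝ) {i : ι} (hi : i ∈ B) :
    ∫ x, pderiv' i g x ^ 2 ∂((lamBs s B).withDensity fun x => ENNReal.ofReal (ϱ x)) ≤
      dirForm s ϱ g g := by
  rw [dirForm_self_eq hmeas hnn]
  have hnn' : ∀ (B : Finset ι) (i : ι), 0 ≤ ∫ x, pderiv' i g x ^ 2
      ∂((lamBs s B).withDensity fun x => ENNReal.ofReal (ϱ x)) :=
    fun _ _ => integral_nonneg fun _ => sq_nonneg _
  exact (Finset.single_le_sum (f := fun i => ∫ x, pderiv' i g x ^ 2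
      ∂((lamBs s B).withDensity fun x => ENNReal.ofReal (ϱ x))) (fun j _ => hnn' B j) hi).trans
    (Finset.single_le_sum (f := fun B => ∑ i ∈ B, ∫ x, pderiv' i g x ^ 2
      ∂((lamBs s B).withDensity fun x => ENNReal.ofReal (ϱ x)))
      (fun B _ => Finset.sum_nonneg fun j _ => hnn' B j) (Finset.mem_univ B))

theorem integral_sq_withDensity_lamBs_le (hint : Integrable ϱ (mns ι s)) {g : (ι → ℝ) → ℝ}
    (hg : Continuous g) (hgc : HasCompactSupport g) (B : Finset ι) :
    ∫ x, g x ^ 2 ∂((lamBs s B).withDensity fun x => ENNReal.ofReal (ϱ x)) ≤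
      ∫ x, g x ^ 2 ∂(muM s ϱ) := by
  have : IsFiniteMeasure (muM s ϱ) := isFiniteMeasure_withDensity_ofReal hint.2
  have hle : (lamBs s B).withDensity (fun x => ENNReal.ofReal (ϱ x)) ≤ muM s ϱ :=
    Measure.le_iff.2 fun t ht => by
      rw [muM, withDensity_apply _ ht, withDensity_apply _ ht]
      exact lintegral_mono' (Measure.restrict_mono le_rfl (lamBs_le_mns s B)) le_rfl
  refine integral_mono_measure hle
    (Eventually.of_forall fun x => sq_nonneg _) ?_
  exact (memLp_two_iff_integrable_sq hg.aestronglyMeasurable).1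
    (hg.memLp_of_hasCompactSupport hgc)

end Closability


/-- closability of the pre-Dirichlet form `(E, C_c²(E))` on `L²(E; μ_{n,s,ϱ})`. -/
theorem preDirichlet_form_closable
    (n : ℕ) (s : ℝ) (hs : 0 < s) (ϱ : (Fin n → ℝ) → ℝ)
    (hmeas : Measurable ϱ) (hnn : ∀ x, 0 ≤ ϱ x)
    (hpos : ∀ᵐ x ∂(mns (Fin n) s), 0 < ϱ x)
    (hint : Integrable ϱ (mns (Fin n) s))
    (hH : CondH s ϱ)
    (f : ℕ → (Fin n → ℝ) → ℝ)
    (hf : ∀ k, ContDiff ℝ 2 (f k) ∧ HasCompactSupport (f k))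
    (hCauchy : Tendsto (fun p : ℕ × ℕ => dirForm s ϱ (f p.1 - f p.2) (f p.1 - f p.2))
      atTop (nhds 0))
    (hL2 : Tendsto (fun k => ∫ x, (f k x) ^ 2 ∂(muM s ϱ)) atTop (nhds 0)) :
    Tendsto (fun k => dirForm s ϱ (f k) (f k)) atTop (nhds 0) := by
  have hf1 : ∀ k, ContDiff ℝ 1 (f k) ∧ HasCompactSupport (f k) := fun k =>
    ⟨(hf k).1.of_le (by norm_num), (hf k).2⟩
  simp only [dirForm_self_eq hmeas hnn (f _)]
  rw [← Finset.sum_const_zero (ι := Finset (Fin n)) (s := Finset.univ)]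
  refine tendsto_finsetSum _ fun B _ => ?_
  rw [← Finset.sum_const_zero (s := B)]
  refine tendsto_finsetSum _ fun i hi => ?_
  refine tendsto_integral_sq_pderiv'_zero hmeas hnn hpos hint hH hi hf1 ?_ ?_
  · refine squeeze_zero (fun _ => integral_nonneg fun _ => sq_nonneg _) (fun p => ?_) hCauchy
    refine le_trans (le_of_eq ?_) (integral_sq_pderiv'_le_dirForm hmeas hnn _ hi)
    simp only [pderiv'_sub i (hf1 p.1).1 (hf1 p.2).1]
  · exact squeeze_zero (fun _ => integral_nonneg fun _ => sq_nonneg _)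
      (fun k => integral_sq_withDensity_lamBs_le hint (hf1 k).1.continuous (hf1 k).2 B) hL2
end

section
/- Assume Condition (D). Then there exists a sequence (f_k)_{k∈ℕ} in C_c^∞(E) with 0 ≤ f_k ≤ 1 and f_k = 1 on [0,k]^n for every k, such that ‖1_E − f_k‖_{L²(E; μ_{n,s,ϱ})} → 0 and E(f_k, f_k) → 0 as k → ∞; in particular (f_k) is a Cauchy sequence with respect to the norm (E(·,·) + ‖·‖²_{L²(E;μ_{n,s,ϱ})})^{1/2} (this yields conservativity: the constant function 1_E belongs to the closure of the form domain and has form energy zero). -/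
open MeasureTheory ENNReal Set Filter
open scoped Classical

/-- If the gradient of `f` is bounded by `c`, the form energy of `f` is at most `c ^ 2` times the
weighted mass of the strata. -/
theorem dirForm_self_le {ι : Type*} [Fintype ι] {s c : ℝ} {ϱ f : (ι → ℝ) → ℝ}
    (hnn : ∀ x, 0 ≤ ϱ x) (hint : Integrable ϱ (mns ι s)) (hf : ∀ x, ‖fderiv ℝ f x‖ ≤ c) :
    dirForm s ϱ f f ≤ c ^ 2 * ∑ B : Finset ι, ∑ i ∈ B, ∫ x in Eplus B, ϱ x ∂(lamBs s B) := by
  unfold dirForm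
  simp only [Finset.mul_sum]
  refine Finset.sum_le_sum fun B _ => Finset.sum_le_sum fun i _ => ?_
  rw [← integral_const_mul]
  have hB : Integrable ϱ (lamBs s B) :=
    (integrable_finsetSum_measure.1 hint) B (Finset.mem_univ B)
  refine integral_mono_of_nonneg
    (.of_forall fun x => mul_nonneg (mul_self_nonneg _) (hnn x))
    (hB.restrict.const_mul _) (.of_forall fun x => ?_)
  have hp : |pderiv' i f x| ≤ c := by
    have h := (fderiv ℝ f x).le_opNorm (Pi.single i (1 : ℝ))
    rw [Pi.norm_single, norm_one, mul_one] at h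
    exact h.trans (hf x)
  have hsq : pderiv' i f x * pderiv' i f x ≤ c ^ 2 := by
    rw [← sq]
    exact sq_le_sq' (abs_le.1 hp).1 (abs_le.1 hp).2
  exact mul_le_mul_of_nonneg_right hsq (hnn x)

theorem dirForm_self_nonneg {ι : Type*} [Fintype ι] {s : ℝ} {ϱ : (ι → ℝ) → ℝ} (f : (ι → ℝ) → ℝ)
    (hnn : ∀ x, 0 ≤ ϱ x) : 0 ≤ dirForm s ϱ f f :=
  Finset.sum_nonneg fun _ _ => Finset.sum_nonneg fun _ _ =>
    integral_nonneg fun x => mul_nonneg (mul_self_nonneg _) (hnn x)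

/-- Rescaled smooth bumps: cutoffs equal to `1` on large balls, with gradients decaying uniformly. -/
theorem exists_smooth_cutoff_sequence (E : Type*) [NormedAddCommGroup E] [NormedSpace ℝ E]
    [FiniteDimensional ℝ E] :
    ∃ (f : ℕ → E → ℝ) (C : ℝ), ∀ k, ContDiff ℝ (⊤ : ℕ∞) (f k) ∧ HasCompactSupport (f k) ∧
      (∀ x, 0 ≤ f k x ∧ f k x ≤ 1) ∧ (∀ x, ‖x‖ ≤ k → f k x = 1) ∧
      ∀ x, ‖fderiv ℝ (f k) x‖ ≤ C / (k + 1) := by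
  let φ : ContDiffBump (0 : E) := ⟨1, 2, one_pos, one_lt_two⟩
  have hφ : ContDiff ℝ (⊤ : ℕ∞) φ := φ.contDiff
  obtain ⟨C, hC⟩ := (hφ.continuous_fderiv (by simp)).bounded_above_of_compact_support
    (φ.hasCompactSupport.fderiv ℝ)
  refine ⟨fun k x => φ (((k : ℝ) + 1)⁻¹ • x), C, fun k => ?_⟩
  have hk : (0 : ℝ) < (k : ℝ) + 1 := by positivity
  refine ⟨hφ.comp (contDiff_const_smul _), φ.hasCompactSupport.comp_smul (inv_ne_zero hk.ne'),
    fun x => ⟨φ.nonneg, φ.le_one⟩, fun x hx => φ.one_of_mem_closedBall ?_, fun x => ?_⟩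
  · rw [mem_closedBall_zero_iff, norm_smul, norm_inv, Real.norm_of_nonneg hk.le]
    exact inv_mul_le_one_of_le₀ (by linarith) hk.le
  · rw [fderiv_comp_smul, norm_smul, norm_inv, Real.norm_of_nonneg hk.le, div_eq_inv_mul]
    exact mul_le_mul_of_nonneg_left (hC _) (inv_nonneg.2 hk.le)

/-- conservativity — a sequence of smooth cutoffs approximating `1_E` in the
form norm. -/
theorem conservativity_cutoff_sequence
    (n : ℕ) (s : ℝ) (hs : 0 < s) (ϱ : (Fin n → ℝ) → ℝ)
    (hmeas : Measurable ϱ) (hnn : ∀ x, 0 ≤ ϱ x)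
    (hpos : ∀ᵐ x ∂(mns (Fin n) s), 0 < ϱ x)
    (hint : Integrable ϱ (mns (Fin n) s)) :
    ∃ f : ℕ → (Fin n → ℝ) → ℝ,
      (∀ k, ContDiff ℝ (⊤ : ℕ∞) (f k) ∧ HasCompactSupport (f k) ∧
        (∀ x, 0 ≤ f k x ∧ f k x ≤ 1) ∧
        (∀ x, (∀ i, x i ∈ Set.Icc (0 : ℝ) k) → f k x = 1)) ∧
      Tendsto (fun k => ∫ x, (1 - f k x) ^ 2 ∂(muM s ϱ)) atTop (nhds 0) ∧
      Tendsto (fun k => dirForm s ϱ (f k) (f k)) atTop (nhds 0) ∧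
      (∀ ε : ℝ, 0 < ε → ∃ K : ℕ, ∀ k ≥ K, ∀ l ≥ K,
        dirForm s ϱ (f k - f l) (f k - f l) + ∫ x, (f k x - f l x) ^ 2 ∂(muM s ϱ) < ε) := by
  obtain ⟨f, C, hf⟩ := exists_smooth_cutoff_sequence (Fin n → ℝ)
  choose hsmooth hcpt h01 hone hgrad using hf
  have : IsFiniteMeasure (muM s ϱ) := isFiniteMeasure_withDensity_ofReal hint.2
  have hbdd (k) (x) : ‖(1 - f k x) ^ 2‖ ≤ 1 := by
    rw [Real.norm_of_nonneg (sq_nonneg _)]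
    exact pow_le_one₀ (by linarith [(h01 k x).2]) (by linarith [(h01 k x).1])
  have hasm (k) : AEStronglyMeasurable (fun x => (1 - f k x) ^ 2) (muM s ϱ) :=
    ((continuous_const.sub (hsmooth k).continuous).pow 2).aestronglyMeasurable
  have hInt (k) : Integrable (fun x => (1 - f k x) ^ 2) (muM s ϱ) :=
    .of_bound (hasm k) 1 (.of_forall (hbdd k))
  have hL2 : Tendsto (fun k => ∫ x, (1 - f k x) ^ 2 ∂(muM s ϱ)) atTop (nhds 0) := by
    have h := tendsto_integral_of_dominated_convergence (μ := muM s ϱ) (f := fun _ => (0 : ℝ))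
      (fun _ => (1 : ℝ)) hasm (integrable_const _) (fun k => .of_forall (hbdd k))
      (.of_forall fun x => ?_)
    · simpa using h
    · obtain ⟨K, hK⟩ := exists_nat_ge ‖x‖
      refine tendsto_const_nhds.congr' ?_
      filter_upwards [eventually_ge_atTop K] with k hk
      rw [hone k x (hK.trans (by exact_mod_cast hk))]
      norm_num
  set M := ∑ B : Finset (Fin n), ∑ i ∈ B, ∫ x in Eplus B, ϱ x ∂(lamBs s B)
  have hdecay : Tendsto (fun k : ℕ => C / ((k : ℝ) + 1)) atTop (nhds 0) :=
    tendsto_const_div_atTop_nhds_zero_nat C |>.comp (tendsto_add_atTop_nat 1) |>.congr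
      fun k => by simp
  refine ⟨f, fun k => ⟨hsmooth k, hcpt k, h01 k, fun x hx => hone k x ?_⟩, hL2, ?_, ?_⟩
  · exact (pi_norm_le_iff_of_nonneg k.cast_nonneg).2 fun i => by
      rw [Real.norm_of_nonneg (hx i).1]; exact (hx i).2
  · refine squeeze_zero (fun k => dirForm_self_nonneg _ hnn)
      (fun k => dirForm_self_le hnn hint (hgrad k)) ?_
    have h := (hdecay.pow 2).mul_const M
    rwa [zero_pow two_ne_zero, zero_mul] at h
  · have hpair : Tendsto (fun p : ℕ × ℕ => (C / ((p.1 : ℝ) + 1) + C / ((p.2 : ℝ) + 1)) ^ 2 * M +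
        (2 * ∫ x, (1 - f p.1 x) ^ 2 ∂(muM s ϱ) + 2 * ∫ x, (1 - f p.2 x) ^ 2 ∂(muM s ϱ)))
        (atTop ×ˢ atTop) (nhds 0) := by
      simpa using ((((hdecay.comp tendsto_fst).add (hdecay.comp tendsto_snd)).pow 2).mul_const
        M).add (((hL2.comp tendsto_fst).const_mul 2).add ((hL2.comp tendsto_snd).const_mul 2))
    intro ε hε
    rw [prod_atTop_atTop_eq] at hpair
    obtain ⟨⟨K, L⟩, hKL⟩ := eventually_atTop.1 (hpair.eventually_lt_const hε)
    refine ⟨max K L, fun k hk l hl => lt_of_le_of_lt (add_le_add ?_ ?_)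
      (hKL (k, l) ⟨(le_max_left K L).trans hk, (le_max_right K L).trans hl⟩)⟩
    · refine dirForm_self_le hnn hint fun x => ?_
      rw [fderiv_sub ((hsmooth k).differentiable (by simp) x)
        ((hsmooth l).differentiable (by simp) x)]
      exact (norm_sub_le _ _).trans (add_le_add (hgrad k x) (hgrad l x))
    · rw [← integral_const_mul, ← integral_const_mul,
        ← integral_add ((hInt k).const_mul 2) ((hInt l).const_mul 2)]
      refine integral_mono_of_nonneg (.of_forall fun x => sq_nonneg _)
        (((hInt k).const_mul 2).add ((hInt l).const_mul 2)) (.of_forall fun x => ?_)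
      show (f k x - f l x) ^ 2 ≤ 2 * (1 - f k x) ^ 2 + 2 * (1 - f l x) ^ 2
      nlinarith [sq_nonneg ((1 - f k x) + (1 - f l x))]
end

section
/- Assume Condition (D) and that ϱ is strictly positive on E and extends to a continuously differentiable function on E. Then for all f, g ∈ C_c²(E) the integration-by-parts identity holds: E(f,g) = Σ_{B⊆I} ∫_{E_+(B)} [ −Σ_{i∈B} ( ∂_i² f + ∂_i f · ∂_i(ln ϱ) ) − (1/s) Σ_{i∈I∖B} ∂_i f ] · g · ϱ dλ_B^{n,s}, where for B = I the sum over I∖B is empty and for B = ∅ the sum over B is empty (the B = ∅ term equals −s^{n−1} ϱ(0) g(0) Σ_{i∈I} ∂_i f(0)). -/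
open MeasureTheory ENNReal Set Filter
open scoped Classical

/-- The one-dimensional factor of `lamB`: Lebesgue measure on `[0,∞)` if `p` holds, and the Dirac
measure at `0` otherwise. -/
noncomputable def lamFactor (p : Prop) : Measure ℝ :=
  if p then volume.restrict (Set.Ici 0) else Measure.dirac 0

theorem lamFactor_of_true {p : Prop} (hp : p) : lamFactor p = volume.restrict (Set.Ici 0) :=
  if_pos hp

theorem lamFactor_of_false {p : Prop} (hp : ¬p) : lamFactor p = Measure.dirac 0 :=
  if_neg hp

instance isLocallyFiniteMeasure_lamFactor (p : Prop) : IsLocallyFiniteMeasure (lamFactor p) := by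
  unfold lamFactor; split_ifs <;> infer_instance

instance sigmaFinite_lamFactor (p : Prop) : SigmaFinite (lamFactor p) := by
  unfold lamFactor; split_ifs <;> infer_instance

theorem lamB_eq_pi_lamFactor {ι : Type*} [Fintype ι] (B : Finset ι) :
    lamB B = Measure.pi fun i => lamFactor (i ∈ B) := by
  unfold lamB lamFactor
  congr!

instance isLocallyFiniteMeasure_lamB {ι : Type*} [Fintype ι] (B : Finset ι) :
    IsLocallyFiniteMeasure (lamB B) := by
  rw [lamB_eq_pi_lamFactor]; infer_instance

instance isFiniteMeasureOnCompacts_lamBs {ι : Type*} [Fintype ι] (s : ℝ) (B : Finset ι) :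
    IsFiniteMeasureOnCompacts (lamBs s B) :=
  IsFiniteMeasureOnCompacts.smul (lamB B) ENNReal.ofReal_ne_top

theorem ae_lamB_mem_Eplus {ι : Type*} [Fintype ι] (B : Finset ι) :
    ∀ᵐ x ∂(lamB B), x ∈ Eplus B := by
  have h : ∀ i, ∀ᵐ x ∂(lamB B), (i ∈ B → 0 < x i) ∧ (i ∉ B → x i = 0) := by
    intro i
    rw [lamB_eq_pi_lamFactor]
    refine (Measure.tendsto_eval_ae_ae (i := i)).eventually
      (p := fun t : ℝ => (i ∈ B → 0 < t) ∧ (i ∉ B → t = 0)) ?_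
    by_cases hi : i ∈ B
    · simp only [hi, true_imp_iff, not_true_eq_false, false_imp_iff, and_true]
      rw [lamFactor_of_true trivial, ← Measure.restrict_congr_set Ioi_ae_eq_Ici]
      exact ae_restrict_mem measurableSet_Ioi
    · simp [hi, lamFactor_of_false, ae_dirac_eq]
  filter_upwards [ae_all_iff.2 h] with x hx
  exact ⟨fun i => (hx i).1, fun i => (hx i).2⟩

theorem ae_lamBs_mem_Eplus {ι : Type*} [Fintype ι] (s : ℝ) (B : Finset ι) :
    ∀ᵐ x ∂(lamBs s B), x ∈ Eplus B :=
  Measure.ae_smul_measure (ae_lamB_mem_Eplus B) _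

theorem lamBs_restrict_Eplus {ι : Type*} [Fintype ι] (s : ℝ) (B : Finset ι) :
    (lamBs s B).restrict (Eplus B) = lamBs s B :=
  Measure.restrict_eq_self_of_ae_mem (ae_lamBs_mem_Eplus s B)

theorem Eplus_subset_Esp {ι : Type*} [Fintype ι] (B : Finset ι) : Eplus B ⊆ Esp ι := by
  intro x hx i
  by_cases hi : i ∈ B
  · exact (hx.1 i hi).le
  · exact (hx.2 i hi).ge

theorem contDiff_pderiv' {ι : Type*} [Fintype ι] {f : (ι → ℝ) → ℝ} {k m : WithTop ℕ∞}
    (hf : ContDiff ℝ k f) (hmk : m + 1 ≤ k) (i : ι) : ContDiff ℝ m (pderiv' i f) :=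
  (hf.fderiv_right hmk).clm_apply contDiff_const

theorem hasCompactSupport_pderiv'_s7 {ι : Type*} [Fintype ι] {f : (ι → ℝ) → ℝ}
    (hf : HasCompactSupport f) (i : ι) : HasCompactSupport (pderiv' i f) :=
  hf.fderiv_apply ℝ (Pi.single i 1)

theorem pderiv'_mul_s7 {ι : Type*} [Fintype ι] {f g : (ι → ℝ) → ℝ} {x : ι → ℝ}
    (hf : DifferentiableAt ℝ f x) (hg : DifferentiableAt ℝ g x) (i : ι) :
    pderiv' i (fun y => f y * g y) x = pderiv' i f x * g x + f x * pderiv' i g x := by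
  unfold pderiv'
  rw [fderiv_fun_mul hf hg]
  simp only [_root_.add_apply, _root_.smul_apply, smul_eq_mul]
  ring

theorem pderiv'_log {ι : Type*} [Fintype ι] {f : (ι → ℝ) → ℝ} {x : ι → ℝ}
    (hf : DifferentiableAt ℝ f x) (hx : f x ≠ 0) (i : ι) :
    pderiv' i (fun y => Real.log (f y)) x = pderiv' i f x / f x := by
  unfold pderiv'
  rw [fderiv.log hf hx]
  simp only [_root_.smul_apply, smul_eq_mul]
  ring

theorem deriv_comp_insertNth {m : ℕ} {u : (Fin (m + 1) → ℝ) → ℝ} (hu : Differentiable ℝ u)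
    (i : Fin (m + 1)) (y : Fin m → ℝ) (t : ℝ) :
    deriv (fun r => u (i.insertNth r y)) t = pderiv' i u (i.insertNth t y) := by
  have h : HasDerivAt (fun r : ℝ => (i.insertNth r y : Fin (m + 1) → ℝ)) (Pi.single i 1) t := by
    refine hasDerivAt_pi.2 fun j => ?_
    induction j using i.succAboveCases with
    | x => simpa using hasDerivAt_id' t
    | p j => simpa using hasDerivAt_const t (y j)
  have hc := HasFDerivAt.comp_hasDerivAt t (hu (i.insertNth t y)).hasFDerivAt h
  have hd := hc.deriv
  simp only [Function.comp_def] at hd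
  rw [hd, pderiv']
  congr!

theorem hasCompactSupport_comp_insertNth {m : ℕ} {u : (Fin (m + 1) → ℝ) → ℝ}
    (hu : HasCompactSupport u) (i : Fin (m + 1)) (y : Fin m → ℝ) :
    HasCompactSupport (fun r => u (i.insertNth r y)) := by
  refine HasCompactSupport.of_support_subset_isCompact
    (hu.isCompact.image (continuous_apply i)) fun r hr => ?_
  exact ⟨i.insertNth r y, subset_tsupport u hr, by simp⟩

theorem integral_pi_eq_integral_insertNth {m : ℕ} (μ : Fin (m + 1) → Measure ℝ)
    [∀ j, SigmaFinite (μ j)] (i : Fin (m + 1)) {v : (Fin (m + 1) → ℝ) → ℝ}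
    (hv : Integrable v (Measure.pi μ)) :
    ∫ x, v x ∂(Measure.pi μ) =
      ∫ y, ∫ t, v (i.insertNth t y) ∂(μ i) ∂(Measure.pi fun j => μ (i.succAbove j)) := by
  have e := (measurePreserving_piFinSuccAbove μ i).symm
  rw [← e.integral_comp']
  exact integral_prod_symm _ ((e.integrable_comp_emb (MeasurableEquiv.measurableEmbedding _)).2 hv)

theorem integral_pderiv'_lamB {n : ℕ} {B : Finset (Fin n)} {i : Fin n} (hi : i ∈ B)
    {u : (Fin n → ℝ) → ℝ} (hu : ContDiff ℝ 1 u) (hc : HasCompactSupport u) :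
    ∫ x, pderiv' i u x ∂(lamB B) = - ∫ x, u x ∂(lamB (B.erase i)) := by
  cases n with
  | zero => exact i.elim0
  | succ m =>
    have hmem : ∀ j, (i.succAbove j ∈ B.erase i) = (i.succAbove j ∈ B) := fun j => by
      simp [Finset.mem_erase, Fin.succAbove_ne]
    have h₁ : Integrable (pderiv' i u) (lamB B) :=
      (contDiff_pderiv' hu (m := 0) (by simp) i).continuous.integrable_of_hasCompactSupport
        (hasCompactSupport_pderiv'_s7 hc i)
    have h₂ : Integrable u (lamB (B.erase i)) :=
      hu.continuous.integrable_of_hasCompactSupport hc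
    rw [lamB_eq_pi_lamFactor] at h₁ h₂ ⊢
    rw [lamB_eq_pi_lamFactor, integral_pi_eq_integral_insertNth _ i h₁,
      integral_pi_eq_integral_insertNth _ i h₂, ← integral_neg]
    simp only [hmem]
    congr 1
    funext y
    have hins : ContDiff ℝ 1 (fun r : ℝ => (i.insertNth r y : Fin (m + 1) → ℝ)) := by
      refine contDiff_pi.2 fun j => ?_
      induction j using i.succAboveCases with
      | x => simpa using contDiff_fun_id
      | p j => simpa using contDiff_const
    have hcomp := (hasCompactSupport_comp_insertNth hc i y).integral_Ioi_deriv_eq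
      (by exact hu.comp hins) 0
    rw [lamFactor_of_true hi, lamFactor_of_false (Finset.notMem_erase i B), integral_dirac,
      integral_Ici_eq_integral_Ioi,
      ← hcomp]
    congr 1
    funext t
    exact (deriv_comp_insertNth (hu.differentiable one_ne_zero) i y t).symm

theorem integral_pderiv'_lamBs {n : ℕ} {s : ℝ} (hs : 0 < s) {B : Finset (Fin n)} {i : Fin n}
    (hi : i ∈ B) {u : (Fin n → ℝ) → ℝ} (hu : ContDiff ℝ 1 u) (hc : HasCompactSupport u) :
    ∫ x, pderiv' i u x ∂(lamBs s B) = - (1 / s * ∫ x, u x ∂(lamBs s (B.erase i))) := by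
  unfold lamBs
  have hcard : Fintype.card (Fin n) - (B.erase i).card = Fintype.card (Fin n) - B.card + 1 := by
    have h₁ := Finset.card_erase_add_one hi
    have h₂ := Finset.card_le_univ B
    omega
  rw [integral_smul_measure, integral_smul_measure, integral_pderiv'_lamB hi hu hc, hcard,
    ENNReal.toReal_ofReal (by positivity), ENNReal.toReal_ofReal (by positivity), pow_succ]
  simp only [smul_eq_mul]
  field_simp

theorem sum_sum_mem_erase {α M : Type*} [Fintype α] [DecidableEq α] [AddCommMonoid M]
    (F : Finset α → α → M) :
    ∑ B : Finset α, ∑ i ∈ B, F (B.erase i) i = ∑ B : Finset α, ∑ i ∈ Bᶜ, F B i := by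
  rw [Finset.sum_sigma', Finset.sum_sigma']
  refine Finset.sum_bij' (fun p _ => ⟨p.1.erase p.2, p.2⟩) (fun p _ => ⟨insert p.2 p.1, p.2⟩)
    ?_ ?_ ?_ ?_ ?_ <;> rintro ⟨B, i⟩ h <;> simp_all [Finset.insert_erase]


/-- integration by parts identity for the pre-Dirichlet form. -/
theorem preDirichlet_form_integration_by_parts
    (n : ℕ) (s : ℝ) (hs : 0 < s) (ϱ : (Fin n → ℝ) → ℝ)
    (hmeas : Measurable ϱ) (hnn : ∀ x, 0 ≤ ϱ x)
    (hpos : ∀ᵐ x ∂(mns (Fin n) s), 0 < ϱ x)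
    (hint : Integrable ϱ (mns (Fin n) s))
    (hϱC1 : ContDiff ℝ 1 ϱ) (hϱpos : ∀ x ∈ Esp (Fin n), 0 < ϱ x)
    (f g : (Fin n → ℝ) → ℝ)
    (hf : ContDiff ℝ 2 f ∧ HasCompactSupport f)
    (hg : ContDiff ℝ 2 g ∧ HasCompactSupport g) :
    dirForm s ϱ f g = ∑ B : Finset (Fin n), ∫ x in Eplus B,
      ((- ∑ i ∈ B, (pderiv' i (fun y => pderiv' i f y) x
          + pderiv' i f x * pderiv' i (fun y => Real.log (ϱ y)) x))
        - (1 / s) * ∑ i ∈ Bᶜ, pderiv' i f x) * g x * ϱ x ∂(lamBs s B) := by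
  have hh : ∀ i, ContDiff ℝ 1 (fun x => pderiv' i f x * (g x * ϱ x)) := fun i =>
    (contDiff_pderiv' hf.1 (by norm_num [one_add_one_eq_two]) i).mul
      ((hg.1.of_le (by norm_num)).mul hϱC1)
  have hhc : ∀ i, HasCompactSupport (fun x => pderiv' i f x * (g x * ϱ x)) := fun i =>
    (hasCompactSupport_pderiv'_s7 hf.2 i).mul_right
  have hD : ∀ (B : Finset (Fin n)) i,
      Integrable (fun x => pderiv' i f x * pderiv' i g x * ϱ x) (lamBs s B) := fun B i => by
    refine Continuous.integrable_of_hasCompactSupport ?_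
      ((hasCompactSupport_pderiv'_s7 hf.2 i).mul_right.mul_right)
    exact (((contDiff_pderiv' hf.1 (m := 1) (by norm_num [one_add_one_eq_two]) i).continuous).mul
      (contDiff_pderiv' hg.1 (m := 1) (by norm_num [one_add_one_eq_two]) i).continuous).mul
        hϱC1.continuous
  have hP : ∀ (B : Finset (Fin n)) i,
      Integrable (pderiv' i fun x => pderiv' i f x * (g x * ϱ x)) (lamBs s B) := fun B i =>
    (contDiff_pderiv' (hh i) (m := 0) (by simp) i).continuous.integrable_of_hasCompactSupport
      (hasCompactSupport_pderiv'_s7 (hhc i) i)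
  have hI : ∀ (B : Finset (Fin n)) i,
      Integrable (fun x => pderiv' i f x * (g x * ϱ x)) (lamBs s B) := fun B i =>
    (hh i).continuous.integrable_of_hasCompactSupport (hhc i)
  have key : ∀ B : Finset (Fin n), (∫ x in Eplus B,
      ((- ∑ i ∈ B, (pderiv' i (fun y => pderiv' i f y) x
          + pderiv' i f x * pderiv' i (fun y => Real.log (ϱ y)) x))
        - (1 / s) * ∑ i ∈ Bᶜ, pderiv' i f x) * g x * ϱ x ∂(lamBs s B)) =
      ∑ i ∈ B, ∫ x, pderiv' i f x * pderiv' i g x * ϱ x ∂(lamBs s B)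
      + ∑ i ∈ B, 1 / s * ∫ x, pderiv' i f x * (g x * ϱ x) ∂(lamBs s (B.erase i))
      - ∑ i ∈ Bᶜ, 1 / s * ∫ x, pderiv' i f x * (g x * ϱ x) ∂(lamBs s B) := by
    intro B
    have hB : ∀ i ∈ B, 1 / s * ∫ x, pderiv' i f x * (g x * ϱ x) ∂(lamBs s (B.erase i)) =
        - ∫ x, pderiv' i (fun y => pderiv' i f y * (g y * ϱ y)) x ∂(lamBs s B) := fun i hi => by
      rw [integral_pderiv'_lamBs hs hi (hh i) (hhc i), neg_neg]
    have hDP := (integrable_finsetSum B fun i _ => hD B i).sub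
      (integrable_finsetSum B fun i _ => hP B i)
    simp only [Pi.sub_def] at hDP
    rw [lamBs_restrict_Eplus, Finset.sum_congr rfl hB, Finset.sum_neg_distrib,
      ← integral_finsetSum _ fun i _ => hD B i, ← integral_finsetSum _ fun i _ => hP B i,
      ← Finset.mul_sum, ← integral_finsetSum _ fun i _ => hI B i, ← integral_const_mul,
      ← sub_eq_add_neg,
      ← integral_sub (integrable_finsetSum _ fun i _ => hD B i)
        (integrable_finsetSum _ fun i _ => hP B i),
      ← integral_sub hDP ((integrable_finsetSum _ fun i _ => hI B i).const_mul _)]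
    refine integral_congr_ae ?_
    filter_upwards [ae_lamBs_mem_Eplus s B] with x hx
    have hx0 : ϱ x ≠ 0 := (hϱpos x (Eplus_subset_Esp B hx)).ne'
    have dϱ : DifferentiableAt ℝ ϱ x := (hϱC1.differentiable one_ne_zero) x
    have dg : DifferentiableAt ℝ g x := (hg.1.differentiable two_ne_zero) x
    have df : ∀ i, DifferentiableAt ℝ (pderiv' i f) x := fun i =>
      (contDiff_pderiv' hf.1 (m := 1) (by norm_num [one_add_one_eq_two]) i).differentiable
        one_ne_zero x
    simp only [sub_mul, neg_mul, Finset.sum_mul, mul_assoc]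
    rw [← Finset.sum_sub_distrib, ← Finset.sum_neg_distrib]
    congr 1
    refine Finset.sum_congr rfl fun i _ => ?_
    rw [pderiv'_mul_s7 (df i) (by exact dg.mul dϱ), pderiv'_mul_s7 dg dϱ, pderiv'_log dϱ hx0]
    field_simp
    ring
  rw [Finset.sum_congr rfl fun B _ => key B, Finset.sum_sub_distrib, Finset.sum_add_distrib,
    sum_sum_mem_erase fun B i => 1 / s * ∫ x, pderiv' i f x * (g x * ϱ x) ∂(lamBs s B),
    add_sub_cancel_right]
  simp only [dirForm, lamBs_restrict_Eplus]
end

section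
/- Assume Condition (V) and let s ∈ (0,∞). Then exp(−H^V) ∈ L¹(Ω̄⁺; m_{N^d,s}), i.e. the normalizing constant Z := ∫_{Ω̄⁺} exp(−H^V(φ)) dm_{N^d,s}(φ) is finite, so that ϱ := Z^{−1} exp(−H^V) is a probability density with respect to m_{N^d,s}. -/
open MeasureTheory ENNReal Set Filter
open scoped Classical

noncomputable section

/-- A candidate site in `{0,…,N+1}^d` lies in the interior region `D_{d,N} = {1,…,N}^d`. -/
def inD (d N : ℕ) (x : Fin d → Fin (N + 2)) : Prop :=
  ∀ i, 1 ≤ (x i : ℕ) ∧ (x i : ℕ) ≤ N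

/-- Two sites are nearest neighbors: `|x − y|_euc = 1`. -/
def nbr (d N : ℕ) (x y : Fin d → Fin (N + 2)) : Prop :=
  ∑ i, ((x i : ℤ) - (y i : ℤ)) ^ 2 = 1

/-- A site lies in `cl D_{d,N} = D_{d,N} ∪ ∂D_{d,N}`. -/
def inClD (d N : ℕ) (x : Fin d → Fin (N + 2)) : Prop :=
  inD d N x ∨ ∃ y, inD d N y ∧ nbr d N x y

/-- Embedding of interior sites `{1,…,N}^d` (indexed by `Fin d → Fin N`) into `{0,…,N+1}^d`. -/
def emb (d N : ℕ) (x : Fin d → Fin N) : Fin d → Fin (N + 2) :=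
  fun i => ⟨(x i : ℕ) + 1, by have := (x i).isLt; omega⟩

/-- Extension of an interface `φ` by `0` outside the interior region. -/
def extPhi (d N : ℕ) (φ : (Fin d → Fin N) → ℝ) (y : Fin d → Fin (N + 2)) : ℝ :=
  if h : ∀ i, 1 ≤ (y i : ℕ) ∧ (y i : ℕ) ≤ N then
    φ (fun i => ⟨(y i : ℕ) - 1, by have := (h i).1; have := (h i).2; omega⟩)
  else 0

/-- The Hamiltonian `H^V(φ) = (1/2) Σ_{x,y ∈ cl D, |x−y|=1} V(φ_x − φ_y)`
with zero boundary condition. -/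
def Hham (d N : ℕ) (V : ℝ → ℝ) (φ : (Fin d → Fin N) → ℝ) : ℝ :=
  (1 / 2) * ∑ x : Fin d → Fin (N + 2), ∑ y : Fin d → Fin (N + 2),
    if inClD d N x ∧ inClD d N y ∧ nbr d N x y then V (extPhi d N φ x - extPhi d N φ y) else 0

/-- Condition (V) on the pair interaction potential. -/
def CondV (V : ℝ → ℝ) : Prop :=
  (∃ b : ℝ, 0 ≤ b ∧ ∀ r, -b ≤ V r) ∧ ContDiff ℝ 1 V ∧ (∀ r, V (-r) = V r) ∧
    Integrable (fun r => Real.exp (-(V r)))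

/-- If every factor `F a` depends on the coordinate `a` only together with coordinates of smaller
rank, and its integral in the coordinate `a` is at most `K` uniformly in the other coordinates, then
the integral of the product of the factors is at most a power of `K`. -/
theorem lmarginal_prod_le_pow {ι : Type*} [DecidableEq ι] (μ : ι → Measure ℝ)
    [∀ i, SigmaFinite (μ i)] (r : ι → ℕ) (F : ι → (ι → ℝ) → ℝ≥0∞) (K : ℝ≥0∞)
    (hFm : ∀ i, Measurable (F i))
    (hF : ∀ j a, a ≠ j → r j ≤ r a → ∀ x t, F j (Function.update x a t) = F j x)
    (hK : ∀ a x, ∫⁻ t, F a (Function.update x a t) ∂μ a ≤ K) (S : Finset ι) (x : ι → ℝ) :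
    lmarginal μ S (fun y => ∏ i ∈ S, F i y) x ≤ K ^ S.card := by
  induction S using Finset.induction_on_max_value r generalizing x with
  | empty => simp
  | insert a S ha hr ih =>
    rw [lmarginal_insert' _ (Finset.measurable_prod _ fun i _ => hFm i) ha]
    calc lmarginal μ S (fun y => ∫⁻ t, ∏ i ∈ insert a S, F i (Function.update y a t) ∂μ a) x
        ≤ lmarginal μ S (fun y => (∏ i ∈ S, F i y) * K) x := by
          refine lmarginal_mono (fun y => ?_) x
          have h : ∀ t, ∏ i ∈ insert a S, F i (Function.update y a t)
              = (∏ i ∈ S, F i y) * F a (Function.update y a t) := fun t => by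
            rw [Finset.prod_insert ha, mul_comm]
            congr 1
            exact Finset.prod_congr rfl fun i hi =>
              hF i a (fun h => ha (h ▸ hi)) (hr i hi) y t
          simp only [h]
          rw [lintegral_const_mul (f := fun t => F a (Function.update y a t)) _
            ((hFm a).comp (measurable_update y))]
          gcongr
          exact hK a y
      _ = lmarginal μ S (fun y => ∏ i ∈ S, F i y) x * K := by
          unfold lmarginal
          exact lintegral_mul_const _
            ((Finset.measurable_prod _ fun i _ => hFm i).comp measurable_updateFinset)
      _ ≤ K ^ S.card * K := by
          gcongr
          exact ih x
      _ = K ^ (insert a S).card := by rw [Finset.card_insert_of_notMem ha, pow_succ]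

theorem lintegral_pi_prod_le_pow {ι : Type*} [Fintype ι] [DecidableEq ι] (μ : ι → Measure ℝ)
    [∀ i, SigmaFinite (μ i)] (r : ι → ℕ) (F : ι → (ι → ℝ) → ℝ≥0∞) (K : ℝ≥0∞)
    (hFm : ∀ i, Measurable (F i))
    (hF : ∀ j a, a ≠ j → r j ≤ r a → ∀ x t, F j (Function.update x a t) = F j x)
    (hK : ∀ a x, ∫⁻ t, F a (Function.update x a t) ∂μ a ≤ K) :
    ∫⁻ x, ∏ i, F i x ∂Measure.pi μ ≤ K ^ Fintype.card ι := by
  rw [lintegral_eq_lmarginal_univ (0 : ι → ℝ)]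
  exact lmarginal_prod_le_pow μ r F K hFm hF hK Finset.univ 0

/-- The lower neighbor of an interior site in the coordinate direction `k`. -/
def predSite (d N : ℕ) (k : Fin d) (x : Fin d → Fin N) : Fin d → Fin (N + 2) :=
  Function.update (emb d N x) k ⟨x k, by have := (x k).isLt; omega⟩

theorem emb_injective (d N : ℕ) : Function.Injective (emb d N) := fun x y h => by
  funext i
  have := congrArg Fin.val (congrFun h i)
  simp only [emb] at this
  exact Fin.ext (by omega)

theorem inD_emb (d N : ℕ) (x : Fin d → Fin N) : inD d N (emb d N x) := fun i => by
  have := (x i).isLt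
  simp only [emb]
  omega

theorem nbr_comm {d N : ℕ} {x y : Fin d → Fin (N + 2)} (h : nbr d N x y) : nbr d N y x := by
  unfold nbr at h ⊢
  rw [← h]
  exact Finset.sum_congr rfl fun i _ => by ring

theorem nbr_predSite_emb (d N : ℕ) (k : Fin d) (x : Fin d → Fin N) :
    nbr d N (predSite d N k x) (emb d N x) := by
  unfold nbr
  rw [Finset.sum_eq_single k]
  · simp [predSite, emb]
  · intro i _ hi
    simp [predSite, hi]
  · simp

theorem extPhi_emb (d N : ℕ) (φ : (Fin d → Fin N) → ℝ) (x : Fin d → Fin N) :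
    extPhi d N φ (emb d N x) = φ x := by
  have h : ∀ i, 1 ≤ (emb d N x i : ℕ) ∧ (emb d N x i : ℕ) ≤ N := inD_emb d N x
  rw [extPhi, dif_pos h]
  simp [emb]

theorem extPhi_predSite_update (d N : ℕ) (k : Fin d) (φ : (Fin d → Fin N) → ℝ)
    (x a : Fin d → Fin N) (t : ℝ) (h : (x k : ℕ) ≤ a k) :
    extPhi d N (Function.update φ a t) (predSite d N k x) = extPhi d N φ (predSite d N k x) := by
  unfold extPhi
  split_ifs with hx
  · rw [Function.update_of_ne]
    rintro rfl
    have h1 := (hx k).1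
    simp only [predSite, Function.update_self] at h h1
    omega
  · rfl

theorem measurable_extPhi (d N : ℕ) (y : Fin d → Fin (N + 2)) :
    Measurable fun φ : (Fin d → Fin N) → ℝ => extPhi d N φ y := by
  unfold extPhi
  split_ifs
  · exact measurable_pi_apply _
  · exact measurable_const

theorem measurable_Hham (d N : ℕ) {V : ℝ → ℝ} (hV : Measurable V) :
    Measurable (Hham d N V) := by
  unfold Hham
  refine measurable_const.mul (Finset.measurable_sum _ fun x _ =>
    Finset.measurable_sum _ fun y _ => ?_)
  split_ifs
  · exact hV.comp ((measurable_extPhi d N x).sub (measurable_extPhi d N y))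
  · exact measurable_const

/-- Up to a constant, the Hamiltonian dominates the sum of the interactions along the edges in a
fixed coordinate direction that join an interior site to its lower neighbor. -/
theorem exists_sum_predSite_le_Hham (d N : ℕ) (k : Fin d) {V : ℝ → ℝ} {b : ℝ} (hb : 0 ≤ b)
    (hVb : ∀ r, -b ≤ V r) (hsymm : ∀ r, V (-r) = V r) :
    ∃ M : ℝ, ∀ φ : (Fin d → Fin N) → ℝ,
      ∑ x, V (φ x - extPhi d N φ (predSite d N k x)) - M ≤ Hham d N V φ := by
  let P : (Fin d → Fin (N + 2)) × (Fin d → Fin (N + 2)) → Prop := fun p =>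
    inClD d N p.1 ∧ inClD d N p.2 ∧ nbr d N p.1 p.2
  refine ⟨(1 / 2) * ∑ p, if P p then b else 0, fun φ => ?_⟩
  let G : (Fin d → Fin (N + 2)) × (Fin d → Fin (N + 2)) → ℝ := fun p =>
    if P p then V (extPhi d N φ p.1 - extPhi d N φ p.2) + b else 0
  have hH : Hham d N V φ = (1 / 2) * (∑ p, G p - ∑ p, if P p then b else 0) := by
    rw [Hham, ← Finset.sum_sub_distrib, ← Fintype.sum_prod_type'
      (fun x y => if inClD d N x ∧ inClD d N y ∧ nbr d N x y then
        V (extPhi d N φ x - extPhi d N φ y) else 0)]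
    congr 1
    refine Finset.sum_congr rfl fun p _ => ?_
    simp only [G, P]
    split_ifs <;> ring
  have hG : ∀ p, 0 ≤ G p := fun p => by
    simp only [G]
    split_ifs
    · linarith [hVb (extPhi d N φ p.1 - extPhi d N φ p.2)]
    · exact le_rfl
  let T : (Fin d → Fin N) ⊕ (Fin d → Fin N) →
      (Fin d → Fin (N + 2)) × (Fin d → Fin (N + 2)) :=
    Sum.elim (fun x => (emb d N x, predSite d N k x)) (fun x => (predSite d N k x, emb d N x))
  have hne : ∀ x y, emb d N x = predSite d N k y → predSite d N k x ≠ emb d N y :=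
    fun x y h1 h2 => by
      have h1 := congrArg Fin.val (congrFun h1 k)
      have h2 := congrArg Fin.val (congrFun h2 k)
      simp only [emb, predSite, Function.update_self] at h1 h2
      omega
  have hT : Function.Injective T := by
    rintro (x | x) (y | y) h <;> simp only [T, Sum.elim_inl, Sum.elim_inr, Prod.mk.injEq] at h
    · rw [emb_injective d N h.1]
    · exact (hne x y h.1 h.2).elim
    · exact (hne y x h.1.symm h.2.symm).elim
    · rw [emb_injective d N h.2]
  have hle : ∑ q, G (T q) ≤ ∑ p, G p := by
    rw [← Finset.sum_image (f := G) (s := Finset.univ) (g := T) hT.injOn]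
    exact Finset.sum_le_sum_of_subset_of_nonneg (Finset.subset_univ _) fun p _ _ => hG p
  have hcl : ∀ x, inClD d N (emb d N x) := fun x => Or.inl (inD_emb d N x)
  have hcl' : ∀ x, inClD d N (predSite d N k x) := fun x =>
    Or.inr ⟨_, inD_emb d N x, nbr_predSite_emb d N k x⟩
  have h1 : ∀ x, G (T (Sum.inl x)) = V (φ x - extPhi d N φ (predSite d N k x)) + b := fun x => by
    have : P (T (Sum.inl x)) := ⟨hcl x, hcl' x, nbr_comm (nbr_predSite_emb d N k x)⟩
    simp only [G, if_pos this]
    simp only [T, Sum.elim_inl, extPhi_emb]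
  have h2 : ∀ x, G (T (Sum.inr x)) = V (φ x - extPhi d N φ (predSite d N k x)) + b := fun x => by
    have : P (T (Sum.inr x)) := ⟨hcl' x, hcl x, nbr_predSite_emb d N k x⟩
    simp only [G, if_pos this]
    simp only [T, Sum.elim_inr, extPhi_emb]
    rw [← hsymm, neg_sub]
  have h3 : ∑ x, V (φ x - extPhi d N φ (predSite d N k x))
      ≤ ∑ x, (V (φ x - extPhi d N φ (predSite d N k x)) + b) :=
    Finset.sum_le_sum fun x _ => by linarith
  rw [Fintype.sum_sum_type] at hle
  simp only [h1, h2] at hle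
  rw [hH]
  linarith

/-- finiteness of the partition function of the wetting model. -/
theorem partition_function_finite
    (d N : ℕ) (hd : 0 < d) (hN : 0 < N) (s : ℝ) (hs : 0 < s)
    (V : ℝ → ℝ) (hV : CondV V) :
    Integrable (fun φ => Real.exp (-(Hham d N V φ))) (mns (Fin d → Fin N) s) := by
  obtain ⟨⟨b, hb, hVb⟩, hVc, hsymm, hint⟩ := hV
  let k : Fin d := ⟨0, hd⟩
  have hVm : Measurable V := hVc.continuous.measurable
  obtain ⟨M, hM⟩ := exists_sum_predSite_le_Hham d N k hb hVb hsymm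
  unfold mns
  refine integrable_finsetSum_measure.2 fun B _ => ?_
  refine Integrable.smul_measure ?_ ENNReal.ofReal_ne_top
  refine ⟨(Real.measurable_exp.comp (measurable_Hham d N hVm).neg).aestronglyMeasurable, ?_⟩
  rw [hasFiniteIntegral_iff_ofReal (ae_of_all _ fun φ => (Real.exp_pos _).le)]
  let F : (Fin d → Fin N) → ((Fin d → Fin N) → ℝ) → ℝ≥0∞ := fun x φ =>
    ENNReal.ofReal (Real.exp (-V (φ x - extPhi d N φ (predSite d N k x))))
  let E : ℝ → ℝ≥0∞ := fun t => ENNReal.ofReal (Real.exp (-V t))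
  let K : ℝ≥0∞ := max (∫⁻ t, E t) (ENNReal.ofReal (Real.exp b))
  have hKtop : K < ⊤ :=
    max_lt ((hasFiniteIntegral_iff_ofReal (ae_of_all _ fun t => (Real.exp_pos _).le)).1 hint.2)
      ENNReal.ofReal_lt_top
  have hFm : ∀ x, Measurable (F x) := fun x =>
    ((hVm.comp ((measurable_pi_apply x).sub (measurable_extPhi d N _))).neg.exp).ennreal_ofReal
  let μ : (Fin d → Fin N) → Measure ℝ := fun i =>
    if i ∈ B then volume.restrict (Set.Ici (0 : ℝ)) else Measure.dirac 0
  have hlam : lamB B = Measure.pi μ := by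
    unfold lamB
    congr 1
    funext i
    congr
  have hμ : ∀ i, SigmaFinite (μ i) := fun i => by
    simp only [μ]
    split_ifs <;> infer_instance
  have hF : ∀ j a, a ≠ j → (j k : ℕ) ≤ a k → ∀ φ t, F j (Function.update φ a t) = F j φ :=
    fun j a haj hr φ t => by
      simp only [F]
      rw [extPhi_predSite_update d N k φ j a t hr, Function.update_of_ne haj.symm]
  have hK : ∀ a φ, ∫⁻ t, F a (Function.update φ a t) ∂μ a ≤ K := fun a φ => by
    have h : ∀ t, F a (Function.update φ a t)
        = E (t - extPhi d N φ (predSite d N k a)) := fun t => by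
      simp only [F, E]
      rw [extPhi_predSite_update d N k φ a a t le_rfl, Function.update_self]
    simp only [h, μ]
    split_ifs
    · calc _ ≤ ∫⁻ t, E (t - extPhi d N φ (predSite d N k a)) := setLIntegral_le_lintegral _ _
        _ = ∫⁻ t, E t := lintegral_sub_right_eq_self E _
        _ ≤ K := le_max_left _ _
    · rw [lintegral_dirac]
      refine le_trans (ENNReal.ofReal_le_ofReal (Real.exp_le_exp.2 ?_)) (le_max_right _ _)
      linarith [hVb (0 - extPhi d N φ (predSite d N k a))]
  calc ∫⁻ φ, ENNReal.ofReal (Real.exp (-(Hham d N V φ))) ∂lamB B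
      ≤ ∫⁻ φ, ENNReal.ofReal (Real.exp M) * ∏ x, F x φ ∂Measure.pi μ := by
        rw [hlam]
        refine lintegral_mono fun φ => ?_
        simp only [F]
        rw [← ENNReal.ofReal_prod_of_nonneg fun x _ => (Real.exp_pos _).le, ← Real.exp_sum,
          ← ENNReal.ofReal_mul (Real.exp_pos _).le, ← Real.exp_add, Finset.sum_neg_distrib]
        refine ENNReal.ofReal_le_ofReal (Real.exp_le_exp.2 ?_)
        linarith [hM φ]
    _ = ENNReal.ofReal (Real.exp M) * ∫⁻ φ, ∏ x, F x φ ∂Measure.pi μ :=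
        lintegral_const_mul _ (Finset.measurable_prod _ fun i _ => hFm i)
    _ ≤ ENNReal.ofReal (Real.exp M) * K ^ Fintype.card (Fin d → Fin N) := by
        gcongr
        exact lintegral_pi_prod_le_pow μ (fun x => (x k : ℕ)) F K hFm hF hK
    _ < ⊤ := ENNReal.mul_lt_top ENNReal.ofReal_lt_top (ENNReal.pow_lt_top hKtop)

end
end

section
/- Assume Condition (V), let s ∈ (0,∞), assume Z := ∫ exp(−H^V) dm_{N^d,s} < ∞, and set ϱ := Z^{−1} exp(−H^V). Then ϱ is continuous and strictly positive on Ω̄⁺, and ϱ satisfies the Hamza condition: for every ∅ ≠ B ⊆ D_{d,N} and every x ∈ cl E_+(B) there exists ε > 0 with ∫_{B_ε(x)} ϱ^{−1} dλ_B^{n,s} < ∞; consequently R_ϱ(cl E_+(B)) = cl E_+(B) and the exceptional set cl E_+(B) ∖ R_ϱ(cl E_+(B)) is empty for every ∅ ≠ B ⊆ D_{d,N}. -/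
open MeasureTheory ENNReal Set Filter
open scoped Classical

noncomputable section

instance lamB_factor_sigmaFinite {ι : Type*} (B : Finset ι) (i : ι) :
    SigmaFinite
      (if i ∈ B then volume.restrict (Set.Ici (0 : ℝ)) else Measure.dirac 0) := by
  split_ifs <;> infer_instance

instance lamB_factor_isLocallyFiniteMeasure {ι : Type*} (B : Finset ι) (i : ι) :
    IsLocallyFiniteMeasure
      (if i ∈ B then volume.restrict (Set.Ici (0 : ℝ)) else Measure.dirac 0) := by
  split_ifs <;> infer_instance

instance lamB_isLocallyFiniteMeasure {ι : Type*} [Fintype ι] (B : Finset ι) :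
    IsLocallyFiniteMeasure (lamB B) :=
  inferInstanceAs (IsLocallyFiniteMeasure (Measure.pi _))

theorem lamB_empty_univ {ι : Type*} [Fintype ι] :
    lamB (∅ : Finset ι) Set.univ = 1 := by
  rw [lamB, Measure.pi_univ]
  exact Finset.prod_eq_one fun i _ => by simp

theorem mns_ne_zero {ι : Type*} [Fintype ι] {s : ℝ} (hs : 0 < s) : mns ι s ≠ 0 := by
  intro h
  have h_le : lamBs s (∅ : Finset ι) Set.univ ≤ mns ι s Set.univ := by
    rw [mns, Measure.finsetSum_apply]
    exact Finset.single_le_sum (f := fun B : Finset ι => lamBs s B Set.univ)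
      (fun _ _ => zero_le) (Finset.mem_univ ∅)
  have h_pos : 0 < s ^ (Fintype.card ι) := pow_pos hs _
  simp [h, lamBs, lamB_empty_univ, h_pos.not_ge] at h_le

theorem dist_le_distE {ι : Type*} [Fintype ι] (x y : ι → ℝ) : dist x y ≤ distE x y := by
  refine (dist_pi_le_iff (Real.sqrt_nonneg _)).2 fun i => ?_
  rw [Real.dist_eq, ← Real.sqrt_sq_eq_abs]
  exact Real.sqrt_le_sqrt
    (Finset.single_le_sum (f := fun j => (x j - y j) ^ 2) (fun _ _ => sq_nonneg _)
      (Finset.mem_univ i))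

/-- A continuous function has finite `lamBs`-integral over Euclidean balls. -/
theorem setLIntegral_distE_le_lt_top {ι : Type*} [Fintype ι] {f : (ι → ℝ) → ℝ}
    (hf : Continuous f) (s : ℝ) (B : Finset ι) (S : Set (ι → ℝ)) (x : ι → ℝ) (ε : ℝ) :
    ∫⁻ y in {y ∈ S | distE x y ≤ ε}, ENNReal.ofReal (f y) ∂(lamBs s B) < ⊤ := by
  have h_sub : {y ∈ S | distE x y ≤ ε} ⊆ Metric.closedBall x ε := fun y hy => by
    rw [Metric.mem_closedBall, dist_comm]
    exact (dist_le_distE x y).trans hy.2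
  refine (lintegral_mono_set h_sub).trans_lt ?_
  rw [lamBs, setLIntegral_smul_measure]
  exact ENNReal.mul_lt_top ENNReal.ofReal_lt_top
    (hf.continuousOn.integrableOn_compact (isCompact_closedBall x ε)).setLIntegral_lt_top

theorem continuous_extPhi (d N : ℕ) (y : Fin d → Fin (N + 2)) :
    Continuous fun φ => extPhi d N φ y := by
  unfold extPhi
  split_ifs <;> fun_prop

theorem continuous_Hham (d N : ℕ) {V : ℝ → ℝ} (hV : Continuous V) :
    Continuous (Hham d N V) := by
  refine continuous_const.mul (continuous_finsetSum _ fun x _ =>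
    continuous_finsetSum _ fun y _ => ?_)
  split_ifs
  · exact hV.comp ((continuous_extPhi d N x).sub (continuous_extPhi d N y))
  · exact continuous_const

/-- the normalized Gibbs density of the wetting model is continuous, strictly
positive and satisfies the Hamza condition everywhere. -/
theorem wetting_density_satisfies_Hamza
    (d N : ℕ) (hd : 0 < d) (hN : 0 < N) (s : ℝ) (hs : 0 < s)
    (V : ℝ → ℝ) (hV : CondV V)
    (hZ : Integrable (fun φ => Real.exp (-(Hham d N V φ))) (mns (Fin d → Fin N) s))
    (Z : ℝ) (hZdef : Z = ∫ φ, Real.exp (-(Hham d N V φ)) ∂(mns (Fin d → Fin N) s))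
    (ϱ : ((Fin d → Fin N) → ℝ) → ℝ)
    (hϱ : ∀ φ, ϱ φ = Z⁻¹ * Real.exp (-(Hham d N V φ))) :
    Continuous ϱ ∧ (∀ φ, 0 < ϱ φ) ∧
    (∀ B : Finset (Fin d → Fin N), B.Nonempty → ∀ x ∈ closure (Eplus B),
      ∃ ε > 0, ∫⁻ y in {y ∈ closure (Eplus B) | distE x y ≤ ε},
        ENNReal.ofReal ((ϱ y)⁻¹) ∂(lamBs s B) < ⊤) ∧
    (∀ B : Finset (Fin d → Fin N), B.Nonempty → Rset s ϱ B = closure (Eplus B)) := by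
  have : NeZero (mns (Fin d → Fin N) s) := ⟨mns_ne_zero hs⟩
  have hZ_pos : 0 < Z := hZdef ▸ integral_exp_pos hZ
  have h_pos : ∀ φ, 0 < ϱ φ := fun φ => by rw [hϱ]; positivity
  have h_cont : Continuous ϱ := by
    rw [funext hϱ]
    exact continuous_const.mul (continuous_Hham d N hV.2.1.continuous).neg.rexp
  have h_hamza (B : Finset (Fin d → Fin N)) (x : (Fin d → Fin N) → ℝ) :=
    setLIntegral_distE_le_lt_top (h_cont.inv₀ fun φ => (h_pos φ).ne') s B (closure (Eplus B)) x 1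
  exact ⟨h_cont, h_pos, fun B _ x _ => ⟨1, one_pos, h_hamza B x⟩, fun B _ =>
    Set.Subset.antisymm (fun _ hx => hx.1) fun x hx => ⟨hx, 1, one_pos, h_hamza B x⟩⟩

end
end
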